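/- arXiv:2206.05767 — 3 statements merged into one kernel-verified Lean document; each statement's English description precedes it below -/
import Mathlib

section
/- Let R be an integral domain with quotient field Q. An R-module M is a Lucas module if and only if the R-module structure on M extends to a Q-vector space structure (i.e., M is a module over Q compatibly with the R-action via the inclusion R → Q). -/
open CategoryTheory

universe u

/-- An ideal is dense if its annihilator in `R` is zero. -/
def Ideal.IsDense {R : Type u} [CommRing R] (I : Ideal R) : Prop :=
  ∀ r : R, (∀ a ∈ I, a * r = 0) → r = 0

/-- An ideal is semi-regular if it contains a finitely generated dense subideal. -/
def Ideal.IsSemiRegular {R : Type u} [CommRing R] (I : Ideal R) : Prop :=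
  ∃ J : Ideal R, J ≤ I ∧ J.FG ∧ J.IsDense

/-- Membership in `𝒬`: finitely generated semi-regular ideals. -/
def Ideal.IsInQ {R : Type u} [CommRing R] (I : Ideal R) : Prop :=
  I.FG ∧ I.IsSemiRegular

/-- An `R`-module is `𝒬`-torsion if every element is annihilated by some `I ∈ 𝒬`. -/
def IsQTorsion (R : Type u) [CommRing R] (M : Type u) [AddCommGroup M] [Module R M] : Prop :=
  ∀ x : M, ∃ I : Ideal R, I.IsInQ ∧ ∀ a ∈ I, a • x = 0

/-- An `R`-module is `𝒬`-torsion-free if no nonzero element is annihilated by any `I ∈ 𝒬`. -/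
def IsQTorsionFree (R : Type u) [CommRing R] (M : Type u) [AddCommGroup M] [Module R M] : Prop :=
  ∀ x : M, (∃ I : Ideal R, I.IsInQ ∧ ∀ a ∈ I, a • x = 0) → x = 0

/-- `Ext¹_R(A, B) = 0`. -/
def Ext1Vanishes (R : Type u) [CommRing R] (A B : Type u) [AddCommGroup A] [Module R A]
    [AddCommGroup B] [Module R B] : Prop :=
  Subsingleton (((Ext R (ModuleCat.{u} R) 1).obj (Opposite.op (ModuleCat.of R A))).obj
    (ModuleCat.of R B))

/-- A Lucas module is a `𝒬`-torsion-free module `M` with `Ext¹_R(R/I, M) = 0` for all `I ∈ 𝒬`. -/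
def IsLucasModule (R : Type u) [CommRing R] (M : Type u) [AddCommGroup M] [Module R M] : Prop :=
  IsQTorsionFree R M ∧ ∀ I : Ideal R, I.IsInQ → Ext1Vanishes R (R ⧸ I) M

/-- The `R`-module structure on `M` extends to a vector space structure over the quotient
field `Q = Frac(R)`, compatibly with the `R`-action via the inclusion `R → Q`. -/
def ExtendsToFractionModule (R : Type u) [CommRing R] [IsDomain R]
    (M : Type u) [AddCommGroup M] [Module R M] : Prop :=
  ∃ inst : Module (FractionRing R) M,
    ∀ (r : R) (m : M), (haveI := inst; (algebraMap R (FractionRing R) r) • m) = r • m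

/-- `Ext¹_R(A, B)` vanishes iff every `1`-cocycle on a projective resolution of `A` with values
in `B` is a coboundary. -/
theorem ext1Vanishes_iff_cocycle_isCoboundary {R : Type u} [CommRing R] {A B : Type u}
    [AddCommGroup A] [Module R A] [AddCommGroup B] [Module R B]
    (P : ProjectiveResolution (ModuleCat.of R A)) :
    Ext1Vanishes R A B ↔ ∀ f : P.complex.X 1 ⟶ ModuleCat.of R B,
      P.complex.d 2 1 ≫ f = 0 → ∃ g : P.complex.X 0 ⟶ ModuleCat.of R B,
        P.complex.d 1 0 ≫ g = f := by
  rw [Ext1Vanishes, ← ModuleCat.isZero_iff_subsingleton,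
    (P.isoExt (R := R) 1 (ModuleCat.of R B)).isZero_iff,
    ← HomologicalComplex.exactAt_iff_isZero_homology,
    HomologicalComplex.exactAt_iff' _ 0 1 2 (by simp) (by simp),
    ShortComplex.moduleCat_exact_iff]
  rfl

/-- `Ext¹_R(A, B)` vanishes when `B` is injective. -/
theorem ext1Vanishes_of_injective {R : Type u} [CommRing R] (A B : Type u)
    [AddCommGroup A] [Module R A] [AddCommGroup B] [Module R B] [Module.Injective R B] :
    Ext1Vanishes R A B := by
  let P := projectiveResolution (ModuleCat.of R A)
  have : Injective (ModuleCat.of R B) := Module.injective_object_of_injective_module R B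
  exact (ext1Vanishes_iff_cocycle_isCoboundary P).2 fun f hf =>
    ⟨(P.exact_succ 0).descToInjective f hf, (P.exact_succ 0).comp_descToInjective f hf⟩

/-- If `Ext¹_R(R/a, M)` vanishes for a nonzero element `a` of a domain, then `M` is
divisible by `a`. -/
theorem smul_surjective_of_ext1Vanishes {R : Type u} [CommRing R] [IsDomain R] {M : Type u}
    [AddCommGroup M] [Module R M] {a : R} (ha : a ≠ 0)
    (h : Ext1Vanishes R (R ⧸ Ideal.span {a}) M) (m : M) : ∃ x : M, a • x = m := by
  let P := projectiveResolution (ModuleCat.of R (R ⧸ Ideal.span {a}))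
  let ε : P.complex.X 0 →ₗ[R] R ⧸ Ideal.span {a} := (P.π.f 0).hom
  let d : P.complex.X 1 →ₗ[R] P.complex.X 0 := (P.complex.d 1 0).hom
  let d' : P.complex.X 2 →ₗ[R] P.complex.X 1 := (P.complex.d 2 1).hom
  have hdd (x) : d (d' x) = 0 :=
    ConcreteCategory.congr_hom (P.complex.d_comp_d 2 1 0) x
  have hεd (x) : ε (d x) = 0 :=
    ConcreteCategory.congr_hom P.complex_d_comp_π_f_zero x
  have hε : Function.Surjective ε := (ModuleCat.epi_iff_surjective (P.π.f 0)).1 inferInstance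
  have hex (y) (hy : ε y = 0) : ∃ x, d x = y :=
    (ShortComplex.moduleCat_exact_iff _).1 P.exact₀ y hy
  have : Module.Projective R (P.complex.X 0) :=
    (IsProjective.iff_projective (P.complex.X 0)).2 (P.projective 0)
  obtain ⟨φ, hφ⟩ := Module.projective_lifting_property (Ideal.span {a}).mkQ ε
    (Submodule.mkQ_surjective _)
  have hφ' (y) : (Ideal.span {a}).mkQ (φ y) = ε y := LinearMap.congr_fun hφ y
  have hdvd (x) : ∃ c, a * c = φ (d x) := by
    have : φ (d x) ∈ Ideal.span {a} := by
      rw [← Submodule.Quotient.mk_eq_zero]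
      exact (hφ' _).trans (hεd x)
    obtain ⟨c, hc⟩ := Ideal.mem_span_singleton.1 this
    exact ⟨c, hc.symm⟩
  choose c hc using hdvd
  let ψ : P.complex.X 1 →ₗ[R] R :=
    { toFun := c
      map_add' := fun x y => mul_left_cancel₀ ha (by simp [mul_add, hc])
      map_smul' := fun r x => mul_left_cancel₀ ha (by
        simp only [hc, map_smul, smul_eq_mul, RingHom.id_apply, mul_left_comm a r]) }
  have hψ (x) : a * ψ x = φ (d x) := hc x
  obtain ⟨g, hg⟩ := (ext1Vanishes_iff_cocycle_isCoboundary P).1 h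
    (ModuleCat.ofHom ((LinearMap.toSpanSingleton R M m).comp ψ)) (by
      ext x
      have : ψ (d' x) = 0 := mul_left_cancel₀ ha (by rw [hψ, hdd, map_zero, mul_zero])
      change ψ (d' x) • m = 0
      rw [this, zero_smul])
  have hg' (x) : g.hom (d x) = ψ x • m := ConcreteCategory.congr_hom hg x
  obtain ⟨p, hp⟩ := hε (Ideal.Quotient.mk _ 1)
  obtain ⟨q, hq⟩ := hex (a • p) (by
    rw [map_smul, hp]
    exact (Submodule.Quotient.mk_eq_zero _).2 (Ideal.mem_span_singleton.2 ⟨1, by simp⟩))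
  have hψq : ψ q = φ p := mul_left_cancel₀ ha (by rw [hψ, hq, map_smul, smul_eq_mul])
  obtain ⟨b, hb⟩ := Ideal.mem_span_singleton.1
    ((Submodule.Quotient.eq _).1 ((hφ' p).trans hp))
  have key := hg' q
  rw [hq, hψq, sub_eq_iff_eq_add.1 hb, map_smul, add_smul, one_smul, mul_smul] at key
  exact ⟨g.hom p - b • m, by rw [smul_sub, key, add_sub_cancel_left]⟩

theorem Ideal.isInQ_span_singleton {R : Type u} [CommRing R] [IsDomain R] {a : R} (ha : a ≠ 0) :
    (Ideal.span {a}).IsInQ := by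
  have hfg : (Ideal.span {a}).FG := ⟨{a}, by simp⟩
  exact ⟨hfg, _, le_rfl, hfg, fun r hr =>
    (mul_eq_zero.1 (hr a (Ideal.mem_span_singleton_self a))).resolve_left ha⟩

theorem Ideal.IsInQ.exists_ne_zero {R : Type u} [CommRing R] [Nontrivial R] {I : Ideal R}
    (hI : I.IsInQ) : ∃ a ∈ I, a ≠ 0 := by
  obtain ⟨-, J, hJI, -, hJ⟩ := hI
  by_contra! h
  exact one_ne_zero (hJ 1 fun a ha => by rw [h a (hJI ha), zero_mul])

/-- A module on which all nonzero elements of a domain act bijectively is a vector space over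
the fraction field. -/
theorem extendsToFractionModule_of_bijective {R : Type u} [CommRing R] [IsDomain R] {M : Type u}
    [AddCommGroup M] [Module R M]
    (h : ∀ a : R, a ≠ 0 → Function.Bijective fun x : M => a • x) :
    ExtendsToFractionModule R M := by
  have : IsLocalizedModule (nonZeroDivisors R) (LinearMap.id : M →ₗ[R] M) :=
    { map_units := fun s => (Module.End.isUnit_iff _).2 (h s (nonZeroDivisors.ne_zero s.2))
      surj := fun y => ⟨(y, 1), by simp⟩
      exists_of_eq := fun hxy => ⟨1, by simpa using hxy⟩ }
  let e : LocalizedModule (nonZeroDivisors R) M ≃ₗ[R] M :=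
    IsLocalizedModule.iso (nonZeroDivisors R) LinearMap.id
  let inst : Module (FractionRing R) M :=
    { smul := fun q m => e (q • e.symm m)
      one_smul := fun m => by change e _ = _; simp
      mul_smul := fun q q' m => by
        change e _ = e (_ • e.symm (e _)); rw [e.symm_apply_apply, mul_smul]
      smul_zero := fun q => by change e _ = _; simp
      smul_add := fun q m m' => by change e _ = e _ + e _; simp
      add_smul := fun q q' m => by change e _ = e _ + e _; rw [add_smul, map_add]
      zero_smul := fun m => by change e _ = _; simp }
  refine ⟨inst, fun r m => ?_⟩
  change e (algebraMap R (FractionRing R) r • e.symm m) = r • m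
  rw [algebraMap_smul, map_smul, e.apply_symm_apply]

theorem ExtendsToFractionModule.bijective_smul {R : Type u} [CommRing R] [IsDomain R] {M : Type u}
    [AddCommGroup M] [Module R M] (h : ExtendsToFractionModule R M) {a : R} (ha : a ≠ 0) :
    Function.Bijective fun x : M => a • x := by
  obtain ⟨inst, h⟩ := h
  have ha' : algebraMap R (FractionRing R) a ≠ 0 := by simpa using ha
  simp_rw [← h a]
  exact MulAction.bijective₀ ha'

/-- A torsion-free divisible module over a domain is injective. -/
theorem Module.Injective.of_bijective_smul {R : Type u} [CommRing R] [IsDomain R] {M : Type u}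
    [AddCommGroup M] [Module R M]
    (h : ∀ a : R, a ≠ 0 → Function.Bijective fun x : M => a • x) : Module.Injective R M := by
  refine Module.Baer.injective fun I f => ?_
  by_cases hI : ∃ b ∈ I, b ≠ 0
  · obtain ⟨b, hb, hb0⟩ := hI
    obtain ⟨x, hx : b • x = f ⟨b, hb⟩⟩ := (h b hb0).2 (f ⟨b, hb⟩)
    refine ⟨LinearMap.toSpanSingleton R M x, fun a ha => (h b hb0).1 ?_⟩
    change b • a • x = b • f ⟨a, ha⟩
    rw [smul_comm, hx, ← map_smul, ← map_smul]
    exact congrArg f (Subtype.ext (mul_comm a b))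
  · push Not at hI
    refine ⟨0, fun a ha => ?_⟩
    have : (⟨a, ha⟩ : I) = 0 := Subtype.ext (hI a ha)
    rw [this, map_zero, LinearMap.zero_apply]

/-- Over an integral domain `R` with quotient field `Q`, an `R`-module is a
Lucas module iff its module structure extends to a `Q`-vector space structure. -/
theorem lucas_iff_extends_to_fractionField (R : Type u) [CommRing R] [IsDomain R]
    (M : Type u) [AddCommGroup M] [Module R M] :
    IsLucasModule R M ↔ ExtendsToFractionModule R M := by
  refine ⟨fun ⟨htf, hext⟩ => extendsToFractionModule_of_bijective fun a ha => ⟨?_, ?_⟩,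
    fun h => ⟨?_, ?_⟩⟩
  · intro x y hxy
    refine sub_eq_zero.1 (htf _ ⟨_, Ideal.isInQ_span_singleton ha, fun b hb => ?_⟩)
    obtain ⟨c, rfl⟩ := Ideal.mem_span_singleton.1 hb
    rw [mul_comm, mul_smul, smul_sub, sub_eq_zero.2 hxy, smul_zero]
  · exact smul_surjective_of_ext1Vanishes ha (hext _ (Ideal.isInQ_span_singleton ha))
  · rintro x ⟨I, hI, hx⟩
    obtain ⟨a, haI, ha⟩ := hI.exists_ne_zero
    exact (h.bijective_smul ha).1 ((hx a haI).trans (smul_zero a).symm)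
  · intro I _
    have := Module.Injective.of_bijective_smul fun a ha => h.bijective_smul (a := a) ha
    exact ext1Vanishes_of_injective _ _
end

section
/- Let R be a commutative ring and ℒ the class of all Lucas R-modules. Then every R-module M has an ℒ-envelope, i.e., there exists an R-homomorphism f : M → F with F a Lucas module such that Hom_R(F, F') → Hom_R(M, F') is surjective for every Lucas module F', and every endomorphism h of F with h ∘ f = f is an isomorphism. -/
open CategoryTheory

universe u

open Limits

/-- If `K ⟶ P ⟶ A` and `K' ⟶ P' ⟶ A` are short exact with `P` and `P'` projective, and every
morphism `K ⟶ Y` extends to `P`, then every morphism `K' ⟶ Y` extends to `P'`. -/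
theorem extends_of_extends {C : Type*} [Category C] [Abelian C] {K P K' P' A Y : C}
    (f : K ⟶ P) (g : P ⟶ A) (w : f ≫ g = 0) (hfg : (ShortComplex.mk f g w).Exact)
    [Mono f] [Epi g] [Projective P]
    (f' : K' ⟶ P') (g' : P' ⟶ A) (w' : f' ≫ g' = 0) (hfg' : (ShortComplex.mk f' g' w').Exact)
    [Mono f'] [Epi g'] [Projective P']
    (H : ∀ φ : K ⟶ Y, ∃ ψ : P ⟶ Y, f ≫ ψ = φ) (φ : K' ⟶ Y) : ∃ ψ : P' ⟶ Y, f' ≫ ψ = φ := by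
  let t : P ⟶ P' := Projective.factorThru g g'
  let s : P' ⟶ P := Projective.factorThru g' g
  have ht : t ≫ g' = g := Projective.factorThru_comp _ _
  have hs : s ≫ g = g' := Projective.factorThru_comp _ _
  have : Mono (ShortComplex.mk f g w).f := ‹Mono f›
  have : Mono (ShortComplex.mk f' g' w').f := ‹Mono f'›
  obtain ⟨t', ht'⟩ : ∃ t' : K ⟶ K', t' ≫ f' = f ≫ t :=
    ⟨_, hfg'.lift_f (f ≫ t) (by simp [ht, w])⟩
  obtain ⟨s', hs'⟩ : ∃ s' : K' ⟶ K, s' ≫ f = f' ≫ s :=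
    ⟨_, hfg.lift_f (f' ≫ s) (by simp [hs, w'])⟩
  obtain ⟨c, hc⟩ : ∃ c : P' ⟶ K', c ≫ f' = s ≫ t - 𝟙 P' :=
    ⟨_, hfg'.lift_f (s ≫ t - 𝟙 P') (by simp [ht, hs])⟩
  obtain ⟨h, hh⟩ := H (t' ≫ φ)
  have key : s' ≫ t' = 𝟙 K' + f' ≫ c := by
    rw [← cancel_mono f']
    simp [ht', reassoc_of% hs', hc]
  refine ⟨s ≫ h - c ≫ φ, ?_⟩
  rw [Preadditive.comp_sub, ← reassoc_of% hs', hh, reassoc_of% key]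
  simp

theorem subsingleton_ext_one_iff_of_resolution {R : Type u} [CommRing R] {X : ModuleCat.{u} R}
    (P : ProjectiveResolution X) (Y : ModuleCat.{u} R) :
    Subsingleton (((Ext R (ModuleCat.{u} R) 1).obj (Opposite.op X)).obj Y) ↔
      ∀ φ : P.complex.X 1 ⟶ Y, P.complex.d 2 1 ≫ φ = 0 →
        ∃ ψ : P.complex.X 0 ⟶ Y, P.complex.d 1 0 ≫ ψ = φ := by
  rw [← ModuleCat.isZero_iff_subsingleton, (P.isoExt 1 Y).isZero_iff,
    ← HomologicalComplex.exactAt_iff_isZero_homology,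
    HomologicalComplex.exactAt_iff' _ 0 1 2 (by simp) (by simp),
    ShortComplex.moduleCat_exact_iff]
  rfl

theorem subsingleton_ext_one_iff {R : Type u} [CommRing R] {K P A : ModuleCat.{u} R}
    (f : K ⟶ P) (g : P ⟶ A) (w : f ≫ g = 0) (hfg : (ShortComplex.mk f g w).Exact)
    [Mono f] [Epi g] [Projective P] (Y : ModuleCat.{u} R) :
    Subsingleton (((Ext R (ModuleCat.{u} R) 1).obj (Opposite.op A)).obj Y) ↔
      ∀ φ : K ⟶ Y, ∃ ψ : P ⟶ Y, f ≫ ψ = φ := by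
  let Q := ProjectiveResolution.of A
  rw [subsingleton_ext_one_iff_of_resolution Q]
  let π : Q.complex.X 0 ⟶ A := Q.π.f 0
  have : Epi π := inferInstanceAs (Epi (Q.π.f 0))
  have w₀ : Q.complex.d 1 0 ≫ π = 0 := Q.complex_d_comp_π_f_zero
  have h₀ : (ShortComplex.mk _ _ w₀).Exact := Q.exact₀
  let e := kernel.lift π (Q.complex.d 1 0) w₀
  have he : e ≫ kernel.ι π = Q.complex.d 1 0 := kernel.lift_ι _ _ _
  have : Epi e := h₀.epi_kernelLift
  have we : Q.complex.d 2 1 ≫ e = 0 := by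
    simp [← cancel_mono (kernel.ι π), he]
  have h₁ : (ShortComplex.mk _ _ we).Exact := by
    let α : ShortComplex.mk _ _ we ⟶
        ShortComplex.mk _ _ (Q.complex.d_comp_d 2 1 0) :=
      { τ₁ := 𝟙 _, τ₂ := 𝟙 _, τ₃ := kernel.ι π }
    have : Epi α.τ₁ := inferInstanceAs (Epi (𝟙 _))
    have : IsIso α.τ₂ := inferInstanceAs (IsIso (𝟙 _))
    have : Mono α.τ₃ := inferInstanceAs (Mono (kernel.ι π))
    exact (ShortComplex.exact_iff_of_epi_of_isIso_of_mono α).2 (Q.exact_succ 0)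
  have hπ : (ShortComplex.mk _ _ (kernel.condition π)).Exact :=
    ShortComplex.exact_kernel π
  trans ∀ φ : kernel π ⟶ Y, ∃ ψ : Q.complex.X 0 ⟶ Y, kernel.ι π ≫ ψ = φ
  · refine ⟨fun H φ => ?_, fun H φ hφ => ?_⟩
    · obtain ⟨ψ, hψ⟩ := H (e ≫ φ) (by simp [reassoc_of% we])
      exact ⟨ψ, by rw [← cancel_epi e, reassoc_of% he, hψ]⟩
    · have : Epi (ShortComplex.mk _ _ we).g := ‹Epi e›
      obtain ⟨φ', hφ'⟩ : ∃ φ' : kernel π ⟶ Y, e ≫ φ' = φ := ⟨_, h₁.g_desc φ hφ⟩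
      obtain ⟨ψ, hψ⟩ := H φ'
      exact ⟨ψ, by rw [← he, Category.assoc, hψ, hφ']⟩
  · exact ⟨extends_of_extends _ _ _ hπ f g w hfg, extends_of_extends f g w hfg _ _ _ hπ⟩

section Presentable

attribute [local instance] Cardinal.fact_isRegular_aleph0

theorem isCardinalPresentable_aleph0_self (R : Type u) [CommRing R] :
    IsCardinalPresentable (ModuleCat.of R R) Cardinal.aleph0.{u} where
  preservesColimitOfShape J _ _ := by
    have : IsFiltered J := isFiltered_of_isCardinalFiltered J Cardinal.aleph0
    have e : coyoneda.obj (Opposite.op (ModuleCat.of R R)) ≅ forget (ModuleCat.{u} R) :=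
      NatIso.ofComponents (fun M => Equiv.toIso
        (ModuleCat.homEquiv.trans (LinearMap.ringLmapEquivSelf R ℕ M).toEquiv))
    exact preservesColimitsOfShape_of_natIso e.symm

theorem isCardinalLocallyPresentable_aleph0_moduleCat (R : Type u) [CommRing R] :
    IsCardinalLocallyPresentable (ModuleCat.{u} R) Cardinal.aleph0.{u} := by
  rw [IsCardinalLocallyPresentable.iff_exists_isStrongGenerator]
  refine ⟨.singleton (ModuleCat.of R R), inferInstance, ?_, ?_⟩
  · rw [ObjectProperty.isStrongGenerator_iff]
    refine ⟨fun X Y f g h => ?_, fun X Y i _ h => ?_⟩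
    · ext x
      simpa using ConcreteCategory.congr_hom
        (h _ (by simp) (ModuleCat.ofHom (LinearMap.toSpanSingleton R X x))) (1 : R)
    · have : Epi i := by
        rw [ModuleCat.epi_iff_surjective]
        intro y
        obtain ⟨a, ha⟩ := h (ModuleCat.of R R) (by simp)
          (ModuleCat.ofHom (LinearMap.toSpanSingleton R Y y))
        refine ⟨a (1 : R), ?_⟩
        simpa using ConcreteCategory.congr_hom ha (1 : R)
      exact isIso_of_mono_of_epi i
  · rw [ObjectProperty.singleton_le_iff]
    exact isCardinalPresentable_aleph0_self R

end Presentable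

theorem exists_forall_isCardinalPresentable (R : Type u) [CommRing R] {ι : Type u}
    (X : ι → ModuleCat.{u} R) :
    ∃ (κ : Cardinal.{u}) (_ : Fact κ.IsRegular), ∀ i, IsCardinalPresentable (X i) κ := by
  classical
  have := Cardinal.fact_isRegular_aleph0.{u}
  have := isCardinalLocallyPresentable_aleph0_moduleCat R
  have : IsLocallyPresentable.{u} (ModuleCat.{u} R) := ⟨_, _, this⟩
  obtain ⟨κ, _, h⟩ := Functor.IsAccessible.exists_cardinal.{u}
    (F := coyoneda.obj (Opposite.op (∐ X)))
  have : IsCardinalPresentable (∐ X) κ := h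
  refine ⟨κ, inferInstance, fun i => ?_⟩
  exact Retract.isCardinalPresentable (X := ∐ X)
    { i := Sigma.ι X i, r := Sigma.desc (Pi.single i (𝟙 (X i)) : (j : ι) → X j ⟶ X i) } κ

/-- The inclusions `I ⟶ R` for `I ∈ 𝒬`; the Lucas modules are their local objects. -/
def lucasHoms (R : Type u) [CommRing R] : MorphismProperty (ModuleCat.{u} R) :=
  .ofHoms fun I : {I : Ideal R // I.IsInQ} =>
    (ModuleCat.ofHom I.1.subtype : ModuleCat.of R I.1 ⟶ ModuleCat.of R R)

theorem ext1Vanishes_quotient_iff {R : Type u} [CommRing R] (I : Ideal R) (Y : ModuleCat.{u} R) :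
    Ext1Vanishes R (R ⧸ I) Y ↔
      Function.Surjective fun ψ : ModuleCat.of R R ⟶ Y =>
        (ModuleCat.ofHom I.subtype : ModuleCat.of R I ⟶ ModuleCat.of R R) ≫ ψ := by
  let f : ModuleCat.of R I ⟶ ModuleCat.of R R := ModuleCat.ofHom I.subtype
  let g : ModuleCat.of R R ⟶ ModuleCat.of R (R ⧸ I) := ModuleCat.ofHom I.mkQ
  have w : f ≫ g = 0 := by
    ext x
    exact (Submodule.Quotient.mk_eq_zero I).2 x.2
  have hfg : (ShortComplex.mk f g w).Exact := by
    rw [ShortComplex.moduleCat_exact_iff]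
    exact fun x hx => ⟨⟨x, (Submodule.Quotient.mk_eq_zero I).1 hx⟩, rfl⟩
  have : Mono f := (ModuleCat.mono_iff_injective _).2 I.subtype_injective
  have : Epi g := (ModuleCat.epi_iff_surjective _).2 I.mkQ_surjective
  have : Projective (ModuleCat.of R R) := inferInstance
  exact subsingleton_ext_one_iff f g w hfg Y

theorem isLucasModule_iff {R : Type u} [CommRing R] (Y : ModuleCat.{u} R) :
    IsLucasModule R Y ↔ (lucasHoms R).isLocal Y := by
  have hinj : IsQTorsionFree R Y ↔ ∀ I : Ideal R, I.IsInQ →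
      Function.Injective fun ψ : ModuleCat.of R R ⟶ Y =>
        (ModuleCat.ofHom I.subtype : ModuleCat.of R I ⟶ ModuleCat.of R R) ≫ ψ := by
    refine ⟨fun h I hI ψ₁ ψ₂ e => ?_, fun h x ⟨I, hI, hx⟩ => ?_⟩
    · ext
      refine sub_eq_zero.1 (h _ ⟨I, hI, fun a ha => ?_⟩)
      have h₁ (ψ : ModuleCat.of R R ⟶ Y) : a • ψ (1 : R) = ψ a := by
        rw [← map_smul, smul_eq_mul, mul_one]
      exact (smul_sub a _ _).trans (sub_eq_zero.2 ((h₁ ψ₁).trans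
        ((ConcreteCategory.congr_hom e (⟨a, ha⟩ : I)).trans (h₁ ψ₂).symm)))
    · have := @h I hI (ModuleCat.ofHom (LinearMap.toSpanSingleton R Y x)) 0 (by
        ext a; exact hx a a.2)
      exact (one_smul R x).symm.trans (ConcreteCategory.congr_hom this (1 : R))
  rw [IsLucasModule, hinj, MorphismProperty.isLocal_iff]
  refine ⟨?_, fun H => ⟨fun I hI => (H _ (.mk ⟨I, hI⟩)).1, fun I hI =>
    (ext1Vanishes_quotient_iff I Y).2 (H _ (.mk ⟨I, hI⟩)).2⟩⟩
  rintro ⟨h₁, h₂⟩ _ _ _ ⟨I, hI⟩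
  exact ⟨h₁ I hI, (ext1Vanishes_quotient_iff I _).1 (h₂ I hI)⟩

/-- Every `R`-module has an envelope with respect to the class `ℒ` of Lucas
modules: there is `f : M → F` with `F` Lucas such that `Hom(F, F') → Hom(M, F')` is
surjective for every Lucas module `F'`, and every endomorphism `h` of `F` with
`h ∘ f = f` is an isomorphism. -/
theorem exists_lucas_envelope (R : Type u) [CommRing R]
    (M : Type u) [AddCommGroup M] [Module R M] :
    ∃ (F : ModuleCat.{u} R) (f : M →ₗ[R] F),
      IsLucasModule R F ∧
      (∀ F' : ModuleCat.{u} R, IsLucasModule R F' →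
        Function.Surjective (fun h : F →ₗ[R] F' => h.comp f)) ∧
      (∀ h : F →ₗ[R] F, h.comp f = f → Function.Bijective h) := by
  obtain ⟨κ, _, hκ⟩ := exists_forall_isCardinalPresentable R
    (fun I : Ideal R => ModuleCat.of R I)
  have hR : IsCardinalPresentable (ModuleCat.of R R) κ :=
    have := hκ ⊤
    isCardinalPresentable_of_iso (X := ModuleCat.of R (⊤ : Ideal R))
      (Submodule.topEquiv (R := R) (M := R)).toModuleIso κ
  have : MorphismProperty.IsSmall.{u} (lucasHoms R) := by
    unfold lucasHoms; infer_instance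
  have : (lucasHoms R).isLocal.ι.IsRightAdjoint :=
    (lucasHoms R).isRightAdjoint_ι_isLocal κ (by rintro _ _ _ ⟨I⟩; exact ⟨hκ I.1, hR⟩)
  let adj := Adjunction.ofIsRightAdjoint (lucasHoms R).isLocal.ι
  let F := (lucasHoms R).isLocal.ι.leftAdjoint.obj (ModuleCat.of R M)
  let f : ModuleCat.of R M ⟶ F.obj := adj.unit.app (ModuleCat.of R M)
  have hf (Z : ModuleCat.{u} R) (hZ : (lucasHoms R).isLocal Z) :
      Function.Bijective fun h : F.obj ⟶ Z => f ≫ h :=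
    ObjectProperty.isLocal_adj_unit_app adj (ModuleCat.of R M) Z ⟨⟨Z, hZ⟩, rfl⟩
  refine ⟨F.obj, f.hom, (isLucasModule_iff _).2 F.property, fun F' hF' h => ?_, fun h hh => ?_⟩
  · obtain ⟨k, hk⟩ := (hf F' ((isLucasModule_iff _).1 hF')).2 (ModuleCat.ofHom h)
    exact ⟨k.hom, congr_arg ModuleCat.Hom.hom hk⟩
  · have := (hf F.obj F.property).1 (a₁ := ModuleCat.ofHom h) (a₂ := 𝟙 _) (by
      ext x; simpa using LinearMap.congr_fun hh x)
    obtain rfl : h = LinearMap.id := congr_arg ModuleCat.Hom.hom this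
    exact Function.bijective_id
end

section
/- Let R be a commutative ring, M a Lucas R-module, and N a pure submodule of M. Then the quotient M/N is a Lucas module. -/
open CategoryTheory

universe u

/-- A submodule `N` of `M` is pure if for every `R`-module `L`, the natural map
`N ⊗ L → M ⊗ L` is injective. -/
def Submodule.IsPureSubmodule {R : Type u} [CommRing R] {M : Type u} [AddCommGroup M]
    [Module R M] (N : Submodule R M) : Prop :=
  ∀ (L : Type u) [AddCommGroup L] [Module R L],
    Function.Injective (LinearMap.rTensor L N.subtype)

/-- A linear map factors through any surjection whose kernel it annihilates. -/
theorem LinearMap.exists_comp_eq_of_ker_le {R A B C : Type*} [Ring R] [AddCommGroup A] [Module R A]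
    [AddCommGroup B] [Module R B] [AddCommGroup C] [Module R C] {α : A →ₗ[R] B} {β : A →ₗ[R] C}
    (hα : Function.Surjective α) (h : LinearMap.ker α ≤ LinearMap.ker β) :
    ∃ g : B →ₗ[R] C, g ∘ₗ α = β := by
  refine ⟨(LinearMap.ker α).liftQ β h ∘ₗ (α.quotKerEquivOfSurjective hα).symm.toLinearMap,
    LinearMap.ext fun a => ?_⟩
  have : (α.quotKerEquivOfSurjective hα).symm (α a) = (LinearMap.ker α).mkQ a := by
    rw [LinearEquiv.symm_apply_eq]; rfl
  simp only [LinearMap.comp_apply, LinearEquiv.coe_coe, this, Submodule.mkQ_apply,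
    Submodule.liftQ_apply]

section Extension

variable {R : Type*} [CommRing R] {I : Ideal R} {M P₀ P₁ P₂ : Type*}
  [AddCommGroup M] [Module R M] [AddCommGroup P₀] [Module R P₀] [AddCommGroup P₁] [Module R P₁]
  [AddCommGroup P₂] [Module R P₂]

/-- Given the start `P₂ → P₁ → P₀ → R ⧸ I → 0` of a projective resolution, every `1`-cocycle with
values in `M` is a coboundary if and only if every linear map `I → M` extends to `R`. -/
theorem forall_cocycle_exists_iff_forall_ideal_extends [Module.Projective R P₀]
    {d₂ : P₂ →ₗ[R] P₁} {d₁ : P₁ →ₗ[R] P₀} {ε : P₀ →ₗ[R] R ⧸ I}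
    (h₁ : Function.Exact d₂ d₁) (h₀ : Function.Exact d₁ ε) (hε : Function.Surjective ε) :
    (∀ c : P₁ →ₗ[R] M, c ∘ₗ d₂ = 0 → ∃ h : P₀ →ₗ[R] M, h ∘ₗ d₁ = c) ↔
      ∀ g : I →ₗ[R] M, ∃ e : R →ₗ[R] M, e ∘ₗ I.subtype = g := by
  obtain ⟨φ, hφ⟩ := Module.projective_lifting_property I.mkQ ε I.mkQ_surjective
  obtain ⟨ψ, hψ⟩ := Module.projective_lifting_property ε I.mkQ hε
  replace hφ p : I.mkQ (φ p) = ε p := LinearMap.congr_fun hφ p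
  replace hψ r : ε (ψ r) = I.mkQ r := LinearMap.congr_fun hψ r
  have φ_mem {p} (hp : ε p = 0) : φ p ∈ I := by
    rwa [← Submodule.Quotient.mk_eq_zero, ← Submodule.mkQ_apply, hφ]
  constructor
  · intro H g
    let φ₁ : P₁ →ₗ[R] I := (φ ∘ₗ d₁).codRestrict I fun p => φ_mem (h₀.apply_apply_eq_zero p)
    obtain ⟨h, hh⟩ := H (g ∘ₗ φ₁) <| by
      ext p
      have : φ₁ (d₂ p) = 0 := Subtype.ext (by simp [φ₁, h₁.apply_apply_eq_zero p])
      simp [this]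
    have hb : 1 - φ (ψ 1) ∈ I := by
      rw [← Submodule.Quotient.mk_eq_zero, ← Submodule.mkQ_apply, map_sub, hφ, hψ, sub_self]
    refine ⟨h ∘ₗ ψ + LinearMap.toSpanSingleton R M (g ⟨_, hb⟩), ?_⟩
    ext a
    obtain ⟨p, hp⟩ := (h₀ (ψ a)).1 (by
      rw [hψ]; exact (Submodule.Quotient.mk_eq_zero _).2 a.2)
    have key : φ₁ p + (a : R) • ⟨_, hb⟩ = a := by
      apply Subtype.ext
      have : ψ (a : R) = (a : R) • ψ 1 := by rw [← map_smul]; simp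
      simp [φ₁, hp, this]
      ring
    have hp' := LinearMap.congr_fun hh p
    simp only [LinearMap.comp_apply, hp] at hp'
    simp only [LinearMap.comp_apply, LinearMap.add_apply, Submodule.subtype_apply, hp',
      LinearMap.toSpanSingleton_apply]
    rw [← map_smul, ← map_add, key]
  · intro H c hc
    obtain ⟨c', hc'⟩ := LinearMap.exists_comp_eq_of_ker_le (β := c) d₁.surjective_rangeRestrict
      fun p hp => by
        obtain ⟨q, rfl⟩ := (h₁ p).1 (congr_arg Subtype.val hp)
        exact LinearMap.congr_fun hc q
    let ψI : I →ₗ[R] LinearMap.range d₁ := (ψ ∘ₗ I.subtype).codRestrict _ fun a =>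
      (h₀ _).1 (by simpa [hψ] using (Submodule.Quotient.mk_eq_zero _).2 a.2)
    let δ : P₀ →ₗ[R] LinearMap.range d₁ := (LinearMap.id - ψ ∘ₗ φ).codRestrict _ fun p =>
      (h₀ _).1 (by
        rw [LinearMap.sub_apply, map_sub, LinearMap.comp_apply, hψ, hφ, LinearMap.id_apply,
          sub_self])
    obtain ⟨e, he⟩ := H (c' ∘ₗ ψI)
    refine ⟨e ∘ₗ φ + c' ∘ₗ δ, ?_⟩
    ext p
    have hmem : φ (d₁ p) ∈ I := φ_mem (h₀.apply_apply_eq_zero p)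
    have he' := LinearMap.congr_fun he ⟨_, hmem⟩
    simp only [LinearMap.comp_apply, Submodule.subtype_apply] at he'
    simp only [LinearMap.comp_apply, LinearMap.add_apply, he', ← map_add]
    rw [← hc', LinearMap.comp_apply]
    congr 1
    apply Subtype.ext
    change ψ (φ (d₁ p)) + (d₁ p - ψ (φ (d₁ p))) = d₁ p
    abel

end Extension

/-- `Ext¹_R(R ⧸ I, M)` vanishes if and only if every linear map `I → M` extends to `R`. -/
theorem ext1Vanishes_quotient_iff_s16 {R : Type u} [CommRing R] (I : Ideal R) (M : Type u)
    [AddCommGroup M] [Module R M] :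
    Ext1Vanishes R (R ⧸ I) M ↔
      ∀ g : I →ₗ[R] M, ∃ e : R →ₗ[R] M, e ∘ₗ I.subtype = g := by
  let P := projectiveResolution (ModuleCat.of R (R ⧸ I))
  let ε : P.complex.X 0 ⟶ ModuleCat.of R (R ⧸ I) := P.π.f 0
  have h₁ : Function.Exact (P.complex.d 2 1).hom (P.complex.d 1 0).hom :=
    (ShortComplex.ShortExact.moduleCat_exact_iff_function_exact _).1 (P.exact_succ 0)
  have h₀ : Function.Exact (P.complex.d 1 0).hom ε.hom :=
    (ShortComplex.ShortExact.moduleCat_exact_iff_function_exact _).1 P.exact₀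
  have hε : Function.Surjective ε.hom := (ModuleCat.epi_iff_surjective ε).1
    (inferInstanceAs (Epi (P.π.f 0)))
  have : Module.Projective R (P.complex.X 0) :=
    (IsProjective.iff_projective _).2 (P.projective 0)
  rw [← forall_cocycle_exists_iff_forall_ideal_extends h₁ h₀ hε, Ext1Vanishes,
    ← ModuleCat.isZero_iff_subsingleton, (P.isoExt 1 (ModuleCat.of R M)).isZero_iff,
    ← HomologicalComplex.exactAt_iff_isZero_homology,
    HomologicalComplex.exactAt_iff' _ 0 1 2 (by simp) (by simp),
    ShortComplex.moduleCat_exact_iff]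
  constructor
  · intro H c hc
    obtain ⟨h, hh⟩ := H (ModuleCat.ofHom c) (ModuleCat.hom_ext hc)
    exact ⟨ModuleCat.Hom.hom h, congr_arg ModuleCat.Hom.hom hh⟩
  · intro H c hc
    obtain ⟨h, hh⟩ := H (ModuleCat.Hom.hom c) (congr_arg ModuleCat.Hom.hom hc)
    exact ⟨ModuleCat.ofHom h, ModuleCat.hom_ext hh⟩

/-- A finite linear system with right-hand side in a pure submodule `N` that is solvable in the
ambient module is solvable in `N`. -/
theorem Submodule.IsPureSubmodule.exists_solution {R : Type u} [CommRing R] {M : Type u}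
    [AddCommGroup M] [Module R M] {N : Submodule R M} (hN : N.IsPureSubmodule)
    {ι κ : Type} [Fintype ι] [Fintype κ] (A : Matrix κ ι R) (x : ι → M)
    (hx : ∀ k, ∑ i, A k i • x i ∈ N) :
    ∃ y : ι → M, (∀ i, y i ∈ N) ∧ ∀ k, ∑ i, A k i • y i = ∑ i, A k i • x i := by
  classical
  let π := (LinearMap.range A.mulVecLin).mkQ
  have hπ : Function.Exact A.mulVecLin π := LinearMap.exact_map_mkQ_range _
  have hπs : Function.Surjective π := Submodule.mkQ_surjective _
  have eval {X : Type u} [AddCommGroup X] [Module R X] (s : TensorProduct R X (ι → R)) (k : κ) :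
      TensorProduct.piScalarRight R R X κ (A.mulVecLin.lTensor X s) k =
        ∑ i, A k i • TensorProduct.piScalarRight R R X ι s i := by
    induction s with
    | zero => simp
    | tmul n f => simp [Matrix.mulVec, dotProduct, Finset.sum_smul, mul_smul]
    | add a b ha hb =>
      simp only [map_add, Pi.add_apply, ha, hb, smul_add, Finset.sum_add_distrib]
  let t : TensorProduct R N (κ → R) :=
    (TensorProduct.piScalarRight R R N κ).symm fun k => ⟨_, hx k⟩
  let s : TensorProduct R M (ι → R) := (TensorProduct.piScalarRight R R M ι).symm x
  have nat (t : TensorProduct R N (κ → R)) (k : κ) :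
      TensorProduct.piScalarRight R R M κ (N.subtype.rTensor _ t) k =
        TensorProduct.piScalarRight R R N κ t k := by
    induction t with
    | zero => simp
    | tmul n f => simp
    | add a b ha hb => simp only [map_add, Pi.add_apply, ha, hb, Submodule.coe_add]
  have hts : N.subtype.rTensor _ t = A.mulVecLin.lTensor M s := by
    apply (TensorProduct.piScalarRight R R M κ).injective
    ext k
    rw [nat, eval]
    simp [t, s]
  have ht : π.lTensor N t = 0 := by
    apply hN
    rw [map_zero, ← LinearMap.comp_apply, LinearMap.rTensor_comp_lTensor,
      ← LinearMap.lTensor_comp_rTensor, LinearMap.comp_apply, hts]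
    exact (lTensor_exact M hπ hπs).apply_apply_eq_zero s
  obtain ⟨y, hy⟩ := (lTensor_exact N hπ hπs t).1 ht
  refine ⟨fun i => TensorProduct.piScalarRight R R N ι y i, fun i => Subtype.prop _, fun k => ?_⟩
  have := congr_arg Subtype.val (eval y k)
  rw [hy] at this
  simpa [t] using this.symm

section Torsion

variable {R : Type u} [CommRing R] {M : Type u} [AddCommGroup M] [Module R M]
  {N : Submodule R M}

theorem Submodule.IsPureSubmodule.isQTorsionFree_quotient (hN : N.IsPureSubmodule)
    (hM : IsQTorsionFree R M) : IsQTorsionFree R (M ⧸ N) := by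
  rintro x ⟨I, hI, hx⟩
  obtain ⟨x, rfl⟩ := N.mkQ_surjective x
  obtain ⟨n, a, ha⟩ := Submodule.fg_iff_exists_fin_generating_family.1 hI.1
  have haI k : a k ∈ I := ha ▸ Submodule.subset_span ⟨k, rfl⟩
  obtain ⟨y, hyN, hy⟩ := hN.exists_solution (ι := Unit) (Matrix.of fun k _ => a k) (fun _ => x)
    fun k => by
      simpa [← Submodule.Quotient.mk_smul, Submodule.Quotient.mk_eq_zero] using hx _ (haI k)
  have : x - y () = 0 := by
    refine hM _ ⟨I, hI, fun r hr => ?_⟩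
    have hle : I ≤ LinearMap.ker (LinearMap.toSpanSingleton R M (x - y ())) := by
      rw [← ha, Submodule.span_le]
      rintro _ ⟨k, rfl⟩
      simpa [smul_sub, sub_eq_zero, eq_comm] using hy k
    exact hle hr
  rw [sub_eq_zero.1 this]
  exact (Submodule.Quotient.mk_eq_zero _).2 (hyN _)

/-- If `M` is `𝒬`-torsion-free and `N` is pure in `M`, then linear maps from ideals in `𝒬` to
`M ⧸ N` lift to `M`. -/
theorem Submodule.IsPureSubmodule.exists_lift_of_isInQ (hN : N.IsPureSubmodule)
    (hM : IsQTorsionFree R M) {I : Ideal R} (hI : I.IsInQ) (f : I →ₗ[R] M ⧸ N) :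
    ∃ g : I →ₗ[R] M, N.mkQ ∘ₗ g = f := by
  obtain ⟨n, a, ha⟩ := Submodule.fg_iff_exists_fin_generating_family.1 hI.1
  have haI k : a k ∈ I := ha ▸ Submodule.subset_span ⟨k, rfl⟩
  choose x hx using fun k => N.mkQ_surjective (f ⟨a k, haI k⟩)
  let A : Matrix (Fin n × Fin n) (Fin n) R := fun p => Pi.single p.2 (a p.1) - Pi.single p.1 (a p.2)
  have hA (z : Fin n → M) p : ∑ i, A p i • z i = a p.1 • z p.2 - a p.2 • z p.1 := by
    simp [A, sub_smul, Pi.single_apply, ite_smul]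
  obtain ⟨y, hyN, hy⟩ := hN.exists_solution A x fun p => by
    rw [hA, ← Submodule.Quotient.mk_eq_zero, ← Submodule.mkQ_apply, map_sub, map_smul, map_smul,
      hx, hx, ← map_smul, ← map_smul, sub_eq_zero]
    exact congr_arg f (Subtype.ext (mul_comm _ _))
  let z := x - y
  have hz i j : a i • z j = a j • z i := by
    have := hy (i, j)
    simp only [hA] at this
    simp only [z, Pi.sub_apply, smul_sub]
    rw [sub_eq_sub_iff_add_eq_add] at this ⊢
    rw [add_comm, add_comm (a j • x i), this, add_comm]
  have hzf i : N.mkQ (z i) = f ⟨a i, haI i⟩ := by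
    rw [← hx i, ← sub_eq_zero, ← map_sub]
    simpa [z] using hyN i
  let α : (Fin n → R) →ₗ[R] I :=
    Fintype.linearCombination R fun k => (⟨a k, haI k⟩ : I)
  let β : (Fin n → R) →ₗ[R] M := Fintype.linearCombination R z
  have hα : Function.Surjective α := by
    rintro ⟨r, hr⟩
    rw [← ha] at hr
    obtain ⟨c, hc⟩ := (Submodule.mem_span_range_iff_exists_fun R).1 hr
    exact ⟨c, Subtype.ext (by simpa [α, Fintype.linearCombination_apply] using hc)⟩
  have hαβ : LinearMap.ker α ≤ LinearMap.ker β := by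
    intro c hc
    have hc' : ∑ i, c i * a i = 0 := by
      simpa [α, Fintype.linearCombination_apply] using congr_arg Subtype.val hc
    refine hM _ ⟨I, hI, fun r hr => ?_⟩
    have hle : I ≤ LinearMap.ker (LinearMap.toSpanSingleton R M (β c)) := by
      rw [← ha, Submodule.span_le]
      rintro _ ⟨k, rfl⟩
      have : a k • β c = (∑ i, c i * a i) • z k := by
        simp only [β, Fintype.linearCombination_apply, Finset.smul_sum, Finset.sum_smul]
        refine Finset.sum_congr rfl fun i _ => ?_
        rw [smul_comm, hz, mul_smul]
      simpa [hc'] using this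
    exact hle hr
  obtain ⟨g, hg⟩ := LinearMap.exists_comp_eq_of_ker_le hα hαβ
  refine ⟨g, LinearMap.ext fun r => ?_⟩
  obtain ⟨c, rfl⟩ := hα r
  rw [LinearMap.comp_apply, ← LinearMap.comp_apply g, hg]
  simp only [α, β, Fintype.linearCombination_apply, map_sum, map_smul, hzf]

end Torsion

/-- The quotient of a Lucas module by a pure submodule is a Lucas module. -/
theorem pure_quotient_lucas (R : Type u) [CommRing R]
    (M : Type u) [AddCommGroup M] [Module R M] (hM : IsLucasModule R M)
    (N : Submodule R M) (hN : N.IsPureSubmodule) :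
    IsLucasModule R (M ⧸ N) := by
  refine ⟨hN.isQTorsionFree_quotient hM.1, fun I hI => ?_⟩
  rw [ext1Vanishes_quotient_iff_s16]
  intro f
  obtain ⟨g, rfl⟩ := hN.exists_lift_of_isInQ hM.1 hI f
  obtain ⟨e, rfl⟩ := (ext1Vanishes_quotient_iff_s16 I M).1 (hM.2 I hI) g
  exact ⟨N.mkQ ∘ₗ e, rfl⟩
end
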